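/- arXiv:2107.05480 — 3 statements merged into one kernel-verified Lean document; each statement's English description precedes it below -/
import Mathlib

section
/- For any 0 < 𝔞 < 𝔟 < ∞ there exists a C² function u : [𝔞,𝔟] → ℝ with u > 0 on (𝔞,𝔟), u(𝔞) = u(𝔟) = 0, and u''(r) = M₋(−(N−1)·m₋(u'(r))/r − r^a·u(r)^p) for all r ∈ (𝔞,𝔟); that is, the Hénon-type equation 𝓜⁻(D²u) + |x|^a u^p = 0 for the Pucci minimal operator has a positive radial solution vanishing on the boundary of the annulus {x ∈ ℝ^N : 𝔞 < |x| < 𝔟}. -/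
open Real Set

/-- `m₋(s) = Λs` for `s ≤ 0`, `λs` for `s > 0`. -/
noncomputable def mminus (lam Lam s : ℝ) : ℝ := if s ≤ 0 then Lam * s else lam * s

/-- `M₋(s) = s/Λ` for `s ≤ 0`, `s/λ` for `s > 0`. -/
noncomputable def Mminus (lam Lam s : ℝ) : ℝ := if s ≤ 0 then s / Lam else s / lam

/-- A pair `w, v` with `w' = v`, `v' = g` on `[A, B]`, normalised by `w A = 0`, `v A = 1`, whose
acceleration `g` obeys the one-sided bounds satisfied by radial solutions. -/
structure IsShootingPair (A B p C k l m μ : ℝ) (w v g : ℝ → ℝ) : Prop where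
  w_left : w A = 0
  v_left : v A = 1
  hasDeriv_w : ∀ t ∈ Icc A B, HasDerivWithinAt w (v t) (Icc A B) t
  hasDeriv_v : ∀ t ∈ Icc A B, HasDerivWithinAt v (g t) (Icc A B) t
  v_le_one : ∀ t ∈ Icc A B, v t ≤ 1
  accel_le : ∀ t ∈ Icc A B, g t ≤ C * max (-v t) 0 - l * μ * max 0 (w t) ^ p
  le_accel : ∀ t ∈ Icc A B, 0 ≤ v t → -k * v t - m * μ * max 0 (w t) ^ p ≤ g t

theorem le_barrier_of_hasDerivWithinAt {A B s e : ℝ} {f f' b b' : ℝ → ℝ} (hs : A ≤ s) (he : e ≤ B)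
    (hf : ∀ t ∈ Icc A B, HasDerivWithinAt f (f' t) (Icc A B) t)
    (hb : ∀ t, HasDerivAt b (b' t) t) (h0 : f s ≤ b s)
    (h : ∀ t ∈ Ico s e, f t = b t → f' t < b' t) : ∀ t ∈ Icc s e, f t ≤ b t := by
  refine image_le_of_deriv_right_lt_deriv_boundary (f' := f') ?_ ?_ h0 hb h
  · intro t ht
    have := (hf t ⟨hs.trans ht.1, ht.2.trans he⟩).continuousWithinAt
    exact this.mono (Icc_subset_Icc hs he)
  · intro t ht
    refine (hf t ⟨hs.trans ht.1, ht.2.le.trans he⟩).mono_of_mem_nhdsWithin ?_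
    refine Filter.mem_of_superset (Icc_mem_nhdsGE ht.2) (Icc_subset_Icc (hs.trans ht.1) he)

theorem barrier_le_of_hasDerivWithinAt {A B s e : ℝ} {f f' b b' : ℝ → ℝ} (hs : A ≤ s) (he : e ≤ B)
    (hf : ∀ t ∈ Icc A B, HasDerivWithinAt f (f' t) (Icc A B) t)
    (hb : ∀ t, HasDerivAt b (b' t) t) (h0 : b s ≤ f s)
    (h : ∀ t ∈ Ico s e, f t = b t → b' t < f' t) : ∀ t ∈ Icc s e, b t ≤ f t := by
  intro t ht
  have := le_barrier_of_hasDerivWithinAt (f := fun t => -f t) (f' := fun t => -f' t)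
    (b := fun t => -b t) (b' := fun t => -b' t) hs he (fun t ht => (hf t ht).neg)
    (fun t => (hb t).neg) (neg_le_neg h0)
    (fun t ht h' => neg_lt_neg (h t ht (neg_injective h'))) t ht
  exact neg_le_neg_iff.1 this

theorem exists_eq_mul_sub_of_hasDerivWithinAt {A B s e : ℝ} {f f' : ℝ → ℝ}
    (hs : A ≤ s) (he : e ≤ B) (hse : s < e)
    (hf : ∀ t ∈ Icc A B, HasDerivWithinAt f (f' t) (Icc A B) t) :
    ∃ x ∈ Ioo s e, f e = f s + f' x * (e - s) := by
  obtain ⟨x, hx, h⟩ := exists_hasDerivAt_eq_slope f f' hse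
    (fun t ht => ((hf t ⟨hs.trans ht.1, ht.2.trans he⟩).continuousWithinAt).mono
      (Icc_subset_Icc hs he))
    (fun t ht => (hf t ⟨hs.trans ht.1.le, ht.2.le.trans he⟩).hasDerivAt
      (Icc_mem_nhds (hs.trans_lt ht.1) (ht.2.trans_le he)))
  refine ⟨x, hx, ?_⟩
  rw [h]
  field_simp [(sub_pos.2 hse).ne']
  ring

namespace IsShootingPair

variable {A B p C k l m μ : ℝ} {w v g : ℝ → ℝ}

theorem v_le_of_neg (h : IsShootingPair A B p C k l m μ w v g) (hC : 0 ≤ C) (hl : 0 ≤ l)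
    (hμ : 0 ≤ μ) {s t : ℝ} (hs : A ≤ s) (hst : s ≤ t) (ht : t ≤ B) (hv : v s < 0) :
    v t ≤ v s * exp (-((C + 1) * (B - A))) := by
  have key := le_barrier_of_hasDerivWithinAt (e := B)
    (b := fun t => v s * exp (-((C + 1) * (t - s))))
    (b' := fun t => v s * (exp (-((C + 1) * (t - s))) * (-((C + 1) * 1)))) hs le_rfl h.hasDeriv_v
    (fun t => ((((hasDerivAt_id t).sub_const s).const_mul (C + 1)).neg.exp).const_mul (v s))
    (by simp) ?_ t ⟨hst, ht⟩
  · refine key.trans ?_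
    have : exp (-((C + 1) * (B - A))) ≤ exp (-((C + 1) * (t - s))) := by
      apply exp_le_exp.2
      nlinarith
    nlinarith
  · intro t ht hvt
    have h1 := h.accel_le t ⟨hs.trans ht.1, ht.2.le⟩
    have h2 : v t < 0 := by
      rw [hvt]; exact mul_neg_of_neg_of_pos hv (exp_pos _)
    rw [max_eq_left (by linarith)] at h1
    have h3 : 0 ≤ l * μ * max 0 (w t) ^ p := by positivity
    have h4 : v s * (exp (-((C + 1) * (t - s))) * (-((C + 1) * 1))) = (C + 1) * (- v t) := by
      rw [hvt]; ring
    rw [h4]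
    linarith

theorem w_right_le_of_neg (h : IsShootingPair A B p C k l m μ w v g) (hC : 0 ≤ C) (hl : 0 ≤ l)
    (hμ : 0 ≤ μ) {s t : ℝ} (hs : A ≤ s) (hst : s ≤ t) (ht : t < B) (hv : v s < 0) :
    w B ≤ w t + v s * exp (-((C + 1) * (B - A))) * (B - t) := by
  obtain ⟨x, hx, e⟩ := exists_eq_mul_sub_of_hasDerivWithinAt (hs.trans hst) le_rfl ht h.hasDeriv_w
  have := h.v_le_of_neg hC hl hμ hs (hst.trans hx.1.le) hx.2.le hv
  rw [e]
  have : 0 < B - t := sub_pos.2 ht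
  gcongr

theorem w_le (h : IsShootingPair A B p C k l m μ w v g) {t : ℝ} (ht : t ∈ Icc A B) :
    w t ≤ t - A := by
  rcases ht.1.eq_or_lt with rfl | hlt
  · simp [h.w_left]
  obtain ⟨x, hx, e⟩ := exists_eq_mul_sub_of_hasDerivWithinAt le_rfl ht.2 hlt h.hasDeriv_w
  rw [h.w_left] at e
  have := h.v_le_one x ⟨hx.1.le, hx.2.le.trans ht.2⟩
  nlinarith

/-- If `w` is nonnegative at the right endpoint, it is positive inside the interval. -/
theorem w_pos (h : IsShootingPair A B p C k l m μ w v g) (hC : 0 ≤ C) (hl : 0 ≤ l)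
    (hμ : 0 ≤ μ) (hB : 0 ≤ w B) {t : ℝ} (ht : t ∈ Ioo A B) : 0 < w t := by
  by_contra! hwt
  have hAB : A < B := ht.1.trans ht.2
  have hc := (h.hasDeriv_v A ⟨le_rfl, hAB.le⟩).continuousWithinAt
  have hpos : ∀ᶠ x in nhdsWithin A (Icc A B), 0 < v x :=
    hc.eventually (lt_mem_nhds (by rw [h.v_left]; exact one_pos))
  rw [nhdsWithin_Icc_eq_nhdsGE hAB] at hpos
  obtain ⟨d, hd, hdpos⟩ := mem_nhdsGE_iff_exists_Icc_subset.1 hpos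
  obtain ⟨r, hAr, hrt, hrd⟩ : ∃ r, A < r ∧ r < t ∧ r ≤ d := by
    obtain ⟨r, h1, h2⟩ := exists_between (lt_min ht.1 hd)
    exact ⟨r, h1, h2.trans_le (min_le_left _ _), (h2.trans_le (min_le_right _ _)).le⟩
  have hwr : 0 < w r := by
    obtain ⟨x, hx, e⟩ := exists_eq_mul_sub_of_hasDerivWithinAt le_rfl (hrt.le.trans ht.2.le) hAr
      h.hasDeriv_w
    rw [e, h.w_left, zero_add]
    exact mul_pos (hdpos ⟨hx.1.le, hx.2.le.trans hrd⟩) (sub_pos.2 hAr)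
  obtain ⟨x, hx, e⟩ := exists_eq_mul_sub_of_hasDerivWithinAt hAr.le ht.2.le hrt h.hasDeriv_w
  have hvx : v x < 0 := by
    by_contra! hcon
    have := mul_nonneg hcon (sub_pos.2 hrt).le
    linarith
  have h1 := h.w_right_le_of_neg hC hl hμ (hAr.trans hx.1).le hx.2.le ht.2 hvx
  have h2 : v x * exp (-((C + 1) * (B - A))) * (B - t) < 0 :=
    mul_neg_of_neg_of_pos (mul_neg_of_neg_of_pos hvx (exp_pos _)) (sub_pos.2 ht.2)
  linarith

theorem half_le_v (h : IsShootingPair A B p C k l m μ w v g) (hp : 0 ≤ p) (hk : 0 ≤ k)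
    (hm : 0 ≤ m) (hμ : 0 ≤ μ) {d : ℝ} (hd : 0 < d) (hdB : A + d ≤ B) (hkd : k * (4 * d) ≤ 1)
    (hμd : m * μ * d ^ p * (8 * d) ≤ 1) : ∀ t ∈ Icc A (A + d), 1 / 2 ≤ v t := by
  have hb : ∀ t, A ≤ t → t ≤ A + d → 1 / 2 ≤ 1 - 1 / (2 * d) * (t - A) ∧
      1 - 1 / (2 * d) * (t - A) ≤ 1 := by
    intro t h1 h2
    have e : 1 / (2 * d) * d = 1 / 2 := by field_simp
    have : 0 < 1 / (2 * d) := by positivity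
    constructor <;> nlinarith
  have key := barrier_le_of_hasDerivWithinAt (s := A) (e := A + d)
    (b := fun t => 1 - 1 / (2 * d) * (t - A)) (b' := fun t => - (1 / (2 * d) * 1))
    le_rfl hdB h.hasDeriv_v
    (fun t => (((hasDerivAt_id t).sub_const A).const_mul (1 / (2 * d))).const_sub 1)
    (by simp [h.v_left]) ?_
  · intro t ht
    exact (hb t ht.1 ht.2).1.trans (key t ht)
  · intro t ht hvt
    have htB : t ∈ Icc A B := ⟨ht.1, ht.2.le.trans hdB⟩
    obtain ⟨h1, h2⟩ := hb t ht.1 ht.2.le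
    have h3 := h.le_accel t htB (by linarith)
    have h4 : max 0 (w t) ^ p ≤ d ^ p := by
      refine rpow_le_rpow (le_max_left _ _) (max_le hd.le ?_) hp
      linarith [h.w_le htB, ht.2]
    have h5 : m * μ * max 0 (w t) ^ p ≤ m * μ * d ^ p := by gcongr
    have h6 : k ≤ 1 / (4 * d) := by rw [le_div_iff₀ (by positivity)]; exact hkd
    have h7 : m * μ * d ^ p ≤ 1 / (8 * d) := by rw [le_div_iff₀ (by positivity)]; exact hμd
    have h8 : k * v t ≤ k * 1 := by gcongr; linarith
    have h9 : 1 / (2 * d) * 1 - 1 / (4 * d) - 1 / (8 * d) = 1 / (8 * d) := by field_simp; norm_num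
    have : 0 < 1 / (8 * d) := by positivity
    linarith

/-- While `w B ≥ 0`, the profile stays above a fixed multiple of `d` up to the midpoint. -/
theorem le_w (h : IsShootingPair A B p C k l m μ w v g) (hp : 0 ≤ p) (hC : 0 ≤ C) (hk : 0 ≤ k)
    (hl : 0 ≤ l) (hm : 0 ≤ m) (hμ : 0 ≤ μ) {d : ℝ} (hd : 0 < d) (hdB : 4 * d ≤ B - A)
    (hkd : k * (4 * d) ≤ 1) (hμd : m * μ * d ^ p * (8 * d) ≤ 1) (hB : 0 ≤ w B) {r : ℝ}
    (hr : A + d ≤ r) (hr' : r ≤ (A + B) / 2) :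
    exp (-((C + 1) * (B - A))) * d / 8 ≤ w r := by
  set E := exp (-((C + 1) * (B - A))) with hE
  have hE1 : E ≤ 1 := by
    rw [hE, exp_le_one_iff]
    have : 0 < B - A := by linarith
    have : 0 ≤ (C + 1) * (B - A) := by positivity
    linarith
  have hE0 : 0 < E := exp_pos _
  have hwd : d / 2 ≤ w (A + d) := by
    obtain ⟨x, hx, e⟩ := exists_eq_mul_sub_of_hasDerivWithinAt (e := A + d) le_rfl (by linarith)
      (by linarith) h.hasDeriv_w
    rw [h.w_left] at e
    have := h.half_le_v hp hk hm hμ hd (by linarith) hkd hμd x ⟨hx.1.le, hx.2.le⟩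
    nlinarith
  by_contra! hcon
  have hEd : E * d ≤ d := by nlinarith
  have hlt : A + d < r := by
    refine lt_of_le_of_ne hr ?_
    rintro rfl
    linarith
  obtain ⟨x, hx, e⟩ := exists_eq_mul_sub_of_hasDerivWithinAt (by linarith) (by linarith : r ≤ B)
      hlt h.hasDeriv_w
  have hvx : v x * (r - (A + d)) < -(d / 4) := by linarith
  have hvx0 : v x < 0 := by
    by_contra! hc
    have := mul_nonneg hc (sub_pos.2 hlt).le
    linarith
  have hvx1 : v x * (B - r) < -(d / 4) := by nlinarith
  have h1 := h.w_right_le_of_neg hC hl hμ (by linarith [hx.1]) hx.2.le (by linarith : r < B) hvx0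
  have h2 : v x * E * (B - r) ≤ -(E * d / 4) := by nlinarith
  have : 0 < E * d := by positivity
  linarith

theorem w_right_neg (h : IsShootingPair A B p C k l m μ w v g) (hp : 0 ≤ p) (hC : 0 ≤ C)
    (hk : 0 ≤ k) (hl : 0 ≤ l) (hm : 0 ≤ m) (hμ : 0 ≤ μ) {d D : ℝ} (hd : 0 < d)
    (hdB : 4 * d ≤ B - A) (hkd : k * (4 * d) ≤ 1) (hμd : m * μ * d ^ p * (8 * d) ≤ 1)
    (hD : 1 + 2 * exp ((C + 1) * (B - A)) < D * (B - A) / 4)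
    (hlD : D * (1 + C * (B - A)) < l * μ * (exp (-((C + 1) * (B - A))) * d / 8) ^ p) :
    w B < 0 := by
  by_contra! hB
  have hAB : 0 < B - A := by linarith
  have hD0 : 0 < D := by
    have : 0 < exp ((C + 1) * (B - A)) := exp_pos _
    by_contra! hc
    nlinarith
  set E := exp (-((C + 1) * (B - A))) with hE
  have hE0 : 0 < E := exp_pos _
  have hEE : E * exp ((C + 1) * (B - A)) = 1 := by rw [hE, ← exp_add]; simp
  have key := le_barrier_of_hasDerivWithinAt (s := A + (B - A) / 4) (e := (A + B) / 2)
    (b := fun t => 1 - D * (t - (A + (B - A) / 4))) (b' := fun t => - (D * 1))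
    (by linarith) (by linarith) h.hasDeriv_v
    (fun t => (((hasDerivAt_id t).sub_const _).const_mul D).const_sub 1)
    (by simpa using h.v_le_one _ ⟨by linarith, by linarith⟩) ?_ ((A + B) / 2)
    ⟨by linarith, le_rfl⟩
  · have h1 : v ((A + B) / 2) ≤ -(2 * exp ((C + 1) * (B - A))) := by
      have : D * ((A + B) / 2 - (A + (B - A) / 4)) = D * (B - A) / 4 := by ring
      simp only [this] at key
      linarith
    have h2 := h.w_right_le_of_neg hC hl hμ (by linarith) le_rfl
      (by linarith : (A + B) / 2 < B) (by linarith [exp_pos ((C + 1) * (B - A))])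
    rw [← hE] at h2
    have h3 : v ((A + B) / 2) * E ≤ -2 := by nlinarith
    have h4 := h.w_le (t := (A + B) / 2) ⟨by linarith, by linarith⟩
    nlinarith
  · intro t ht hvt
    have h1 := h.accel_le t ⟨by linarith [ht.1], by linarith [ht.2]⟩
    have h2 := h.le_w hp hC hk hl hm hμ hd hdB hkd hμd hB (r := t) (by linarith [ht.1]) ht.2.le
    have h3 : (E * d / 8) ^ p ≤ max 0 (w t) ^ p :=
      rpow_le_rpow (by positivity) (h2.trans (le_max_right _ _)) hp
    have h4 : l * μ * (E * d / 8) ^ p ≤ l * μ * max 0 (w t) ^ p := by gcongr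
    have h5 : max (-v t) 0 < D * (B - A) := by
      refine max_lt ?_ (by positivity)
      rw [hvt]
      have : D * (t - (A + (B - A) / 4)) ≤ D * (B - A) := by
        apply mul_le_mul_of_nonneg_left _ hD0.le
        linarith [ht.2]
      linarith
    have h6 : C * max (-v t) 0 ≤ C * (D * (B - A)) := by gcongr
    linarith

end IsShootingPair

/-- For a suitable coupling `μ` every normalised profile crosses zero before `B`. -/
theorem exists_forall_isShootingPair_w_right_neg {A B p C k l m : ℝ} (hAB : A < B) (hp : 0 ≤ p)
    (hC : 0 ≤ C) (hk : 0 ≤ k) (hl : 0 < l) (hm : 0 < m) :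
    ∃ μ > 0, ∀ w v g : ℝ → ℝ, IsShootingPair A B p C k l m μ w v g → w B < 0 := by
  have hK : 0 < B - A := sub_pos.2 hAB
  obtain ⟨D, hD⟩ : ∃ D, 1 + 2 * exp ((C + 1) * (B - A)) < D * (B - A) / 4 := by
    refine ⟨4 / (B - A) * (2 + 2 * exp ((C + 1) * (B - A))), ?_⟩
    have e : 4 / (B - A) * (2 + 2 * exp ((C + 1) * (B - A))) * (B - A) / 4
      = 2 + 2 * exp ((C + 1) * (B - A)) := by field_simp
    rw [e]
    linarith
  set E := exp (-((C + 1) * (B - A))) with hE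
  have hE0 : 0 < E := exp_pos _
  have lim : ∀ c x : ℝ, 0 < x → ∀ᶠ d in nhdsWithin (0 : ℝ) (Ioi 0), c * d < x := by
    intro c x hx
    have : Filter.Tendsto (fun d : ℝ => c * d) (nhdsWithin 0 (Ioi 0)) (nhds 0) := by
      have : Filter.Tendsto (fun d : ℝ => c * d) (nhds 0) (nhds (c * 0)) :=
        (continuous_const.mul continuous_id).tendsto _
      rw [mul_zero] at this
      exact this.mono_left nhdsWithin_le_nhds
    exact this.eventually (gt_mem_nhds hx)
  obtain ⟨d, hd, h1, h2, h3⟩ := (((eventually_mem_nhdsWithin).and ((lim (k * 4) 1 one_pos).and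
    ((lim 4 _ hK).and (lim (D * (1 + C * (B - A)) * (8 * m)) (l * (E / 8) ^ p)
      (by positivity)))))).exists
  have hd : 0 < d := hd
  have hdp : 0 < d ^ p := rpow_pos_of_pos hd p
  refine ⟨1 / (8 * m * d * d ^ p), by positivity, fun w v g h => ?_⟩
  refine h.w_right_neg hp hC hk hl.le hm.le (by positivity) hd h2.le (by linarith)
    (le_of_eq (by field_simp)) hD ?_
  rw [← hE, show E * d / 8 = E / 8 * d by ring, mul_rpow (by positivity) hd.le,
    show l * (1 / (8 * m * d * d ^ p)) * ((E / 8) ^ p * d ^ p) = l * (E / 8) ^ p / (8 * m * d) by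
      field_simp, lt_div_iff₀ (by positivity)]
  linarith

theorem IsShootingPair.w_right_pos {A B p C k l m : ℝ} {w v g : ℝ → ℝ}
    (h : IsShootingPair A B p C k l m 0 w v g) (hAB : A < B) : 0 < w B := by
  have key := barrier_le_of_hasDerivWithinAt (s := A) (e := B)
    (b := fun t => exp (-((k + 1) * (t - A))))
    (b' := fun t => exp (-((k + 1) * (t - A))) * (-((k + 1) * 1))) le_rfl le_rfl h.hasDeriv_v
    (fun t => (((hasDerivAt_id t).sub_const A).const_mul (k + 1)).neg.exp)
    (by simp [h.v_left]) ?_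
  · obtain ⟨x, hx, e⟩ := exists_eq_mul_sub_of_hasDerivWithinAt le_rfl le_rfl hAB h.hasDeriv_w
    rw [e, h.w_left, zero_add]
    exact mul_pos ((exp_pos _).trans_le (key x ⟨hx.1.le, hx.2.le⟩)) (sub_pos.2 hAB)
  · intro t ht hvt
    have hpos := exp_pos (-((k + 1) * (t - A)))
    have := h.le_accel t ⟨ht.1, ht.2.le⟩ (by rw [hvt]; exact hpos.le)
    rw [← hvt] at hpos ⊢
    linarith

theorem mminus_eq_min {lam Lam : ℝ} (hlL : lam ≤ Lam) (s : ℝ) :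
    mminus lam Lam s = min (Lam * s) (lam * s) := by
  unfold mminus
  split_ifs with h
  · rw [min_eq_left]; nlinarith
  · rw [min_eq_right]; nlinarith

theorem Mminus_eq_max {lam Lam : ℝ} (hlam : 0 < lam) (hlL : lam ≤ Lam) (s : ℝ) :
    Mminus lam Lam s = max (s / Lam) (s / lam) := by
  have hLam := hlam.trans_le hlL
  have h1 : 1 / Lam ≤ 1 / lam := one_div_le_one_div_of_le hlam hlL
  rw [div_eq_mul_one_div s Lam, div_eq_mul_one_div s lam]
  unfold Mminus
  split_ifs with h
  · rw [max_eq_left]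
    · ring
    · nlinarith
  · rw [max_eq_right]
    · ring
    · nlinarith

theorem abs_mminus_sub_le {lam Lam : ℝ} (hlam : 0 < lam) (hlL : lam ≤ Lam) (x y : ℝ) :
    |mminus lam Lam x - mminus lam Lam y| ≤ Lam * |x - y| := by
  rw [mminus_eq_min hlL, mminus_eq_min hlL]
  refine (abs_min_sub_min_le_max _ _ _ _).trans (max_le ?_ ?_)
  · rw [← mul_sub, abs_mul, abs_of_pos (hlam.trans_le hlL)]
  · rw [← mul_sub, abs_mul, abs_of_pos hlam]
    gcongr

theorem abs_Mminus_sub_le {lam Lam : ℝ} (hlam : 0 < lam) (hlL : lam ≤ Lam) (x y : ℝ) :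
    |Mminus lam Lam x - Mminus lam Lam y| ≤ |x - y| / lam := by
  rw [Mminus_eq_max hlam hlL, Mminus_eq_max hlam hlL]
  refine (abs_max_sub_max_le_max _ _ _ _).trans (max_le ?_ ?_)
  · rw [← sub_div, abs_div, abs_of_pos (hlam.trans_le hlL)]
    gcongr
  · rw [← sub_div, abs_div, abs_of_pos hlam]

theorem continuous_Mminus {lam Lam : ℝ} (hlam : 0 < lam) (hlL : lam ≤ Lam) :
    Continuous (Mminus lam Lam) := by
  rw [show Mminus lam Lam = fun s => max (s / Lam) (s / lam) from
    funext (Mminus_eq_max hlam hlL)]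
  fun_prop

theorem continuous_mminus {lam Lam : ℝ} (hlL : lam ≤ Lam) : Continuous (mminus lam Lam) := by
  rw [show mminus lam Lam = fun s => min (Lam * s) (lam * s) from funext (mminus_eq_min hlL)]
  fun_prop

theorem mminus_const_mul {lam Lam c : ℝ} (hlL : lam ≤ Lam) (hc : 0 ≤ c) (s : ℝ) :
    mminus lam Lam (c * s) = c * mminus lam Lam s := by
  rw [mminus_eq_min hlL, mminus_eq_min hlL, mul_min_of_nonneg _ _ hc]
  congr 1 <;> ring

theorem Mminus_const_mul {lam Lam c : ℝ} (hlam : 0 < lam) (hlL : lam ≤ Lam) (hc : 0 ≤ c) (s : ℝ) :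
    Mminus lam Lam (c * s) = c * Mminus lam Lam s := by
  rw [Mminus_eq_max hlam hlL, Mminus_eq_max hlam hlL, mul_max_of_nonneg _ _ hc]
  congr 1 <;> ring

/-- The second derivative at radius `t` prescribed by the radial equation, when the first
derivative is `v` and the reaction term is `q`. -/
noncomputable def radialAccel (lam Lam n t v q : ℝ) : ℝ :=
  Mminus lam Lam (-(n * mminus lam Lam v) / t - q)

section radialAccel

variable {lam Lam n t v q A : ℝ}

theorem radialAccel_const_mul {c : ℝ} (hlam : 0 < lam) (hlL : lam ≤ Lam) (hc : 0 ≤ c) :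
    radialAccel lam Lam n t (c * v) (c * q) = c * radialAccel lam Lam n t v q := by
  unfold radialAccel
  rw [← Mminus_const_mul hlam hlL hc, mminus_const_mul hlL hc]
  congr 1
  ring

theorem radialAccel_neg_of_pos (hlam : 0 < lam) (hlL : lam ≤ Lam) (hn : 0 < n) (ht : 0 < t)
    (hv : 0 < v) (hq : 0 ≤ q) : radialAccel lam Lam n t v q < 0 := by
  have hLam := hlam.trans_le hlL
  unfold radialAccel mminus
  rw [if_neg hv.not_ge]
  have h1 : 0 < n * (lam * v) / t := by positivity
  have h2 : -(n * (lam * v)) / t - q < 0 := by rw [neg_div]; linarith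
  rw [Mminus, if_pos h2.le]
  exact div_neg_of_neg_of_pos h2 hLam

theorem radialAccel_pos_of_neg (hlam : 0 < lam) (ht : 0 < t)
    (hv : v < 0) (hq : q * t < n * Lam * (-v)) : 0 < radialAccel lam Lam n t v q := by
  unfold radialAccel mminus
  rw [if_pos hv.le]
  have h2 : 0 < -(n * (Lam * v)) / t - q := by
    rw [sub_pos, lt_div_iff₀ ht]; linarith
  rw [Mminus, if_neg h2.not_ge]
  exact div_pos h2 hlam

theorem radialAccel_le (hlam : 0 < lam) (hlL : lam ≤ Lam) (hn : 0 < n) (hA : 0 < A) (ht : A ≤ t)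
    (hq : 0 ≤ q) :
    radialAccel lam Lam n t v q ≤ n * Lam / (lam * A) * max (-v) 0 - q / Lam := by
  have hLam := hlam.trans_le hlL
  have ht0 := hA.trans_le ht
  unfold radialAccel
  have hqL : q / Lam ≤ q / lam := by gcongr
  rcases le_total v 0 with hv | hv
  · rw [max_eq_left (by linarith), mminus, if_pos hv]
    set X := -(n * (Lam * v)) / t with hX
    have hX' : X = n * Lam * (-v) / t := by rw [hX]; ring
    have hv' : 0 ≤ -v := by linarith
    have hX0 : 0 ≤ X := by rw [hX']; positivity
    have h1 : X / lam ≤ n * Lam / (lam * A) * (-v) := by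
      have e : n * Lam / (lam * A) * (-v) = (n * Lam * (-v) / A) / lam := by field_simp
      rw [e, hX']
      gcongr
    have h2 : X / Lam ≤ X / lam := by gcongr
    rw [Mminus_eq_max hlam hlL, sub_div, sub_div]
    apply max_le <;> linarith
  · rw [max_eq_right (by linarith), mul_zero, zero_sub]
    have h0 : 0 ≤ mminus lam Lam v := by
      rw [mminus_eq_min hlL]; exact le_min (by positivity) (by positivity)
    have h1 : 0 ≤ n * mminus lam Lam v / t := by positivity
    rw [Mminus, if_pos (by rw [neg_div]; linarith), ← neg_div]
    gcongr
    rw [neg_div]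
    linarith

theorem le_radialAccel (hlam : 0 < lam) (hlL : lam ≤ Lam) (hn : 0 < n) (hA : 0 < A) (ht : A ≤ t)
    (hv : 0 ≤ v) :
    -(n / A) * v - q / Lam ≤ radialAccel lam Lam n t v q := by
  have hLam := hlam.trans_le hlL
  have ht0 := hA.trans_le ht
  unfold radialAccel
  rw [Mminus_eq_max hlam hlL]
  refine le_trans ?_ (le_max_left _ _)
  have h1 : mminus lam Lam v ≤ Lam * v := by rw [mminus_eq_min hlL]; exact min_le_left _ _
  have h2 : n * mminus lam Lam v / t / Lam ≤ n * (Lam * v) / A / Lam := by gcongr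
  have h3 : n * (Lam * v) / A / Lam = n / A * v := by field_simp
  rw [sub_div, neg_div, neg_div]
  linarith

theorem abs_radialAccel_sub_le {v' q' : ℝ} (hlam : 0 < lam) (hlL : lam ≤ Lam) (hn : 0 < n)
    (hA : 0 < A) (ht : A ≤ t) :
    |radialAccel lam Lam n t v q - radialAccel lam Lam n t v' q'| ≤
      (n * Lam / A * |v - v'| + |q - q'|) / lam := by
  have hLam := hlam.trans_le hlL
  have ht0 := hA.trans_le ht
  refine (abs_Mminus_sub_le hlam hlL _ _).trans ?_
  gcongr
  have e : -(n * mminus lam Lam v) / t - q - (-(n * mminus lam Lam v') / t - q') =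
      -(n / t * (mminus lam Lam v - mminus lam Lam v')) + (-(q - q')) := by ring
  rw [e]
  refine (abs_add_le _ _).trans ?_
  rw [abs_neg, abs_neg, abs_mul, abs_of_pos (by positivity : 0 < n / t)]
  refine add_le_add ?_ le_rfl
  calc n / t * |mminus lam Lam v - mminus lam Lam v'| ≤ n / A * (Lam * |v - v'|) := by
        gcongr
        exact abs_mminus_sub_le hlam hlL _ _
    _ = n * Lam / A * |v - v'| := by ring

end radialAccel

/-- A bounded, globally Lipschitz vector field has a flow on the whole of `[A, B]`. -/
theorem exists_flow_of_bounded_lipschitz {E : Type*} [NormedAddCommGroup E] [NormedSpace ℝ E]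
    [CompleteSpace E] {F : ℝ → E → E} {A B : ℝ} (hAB : A ≤ B) {L K : NNReal}
    (hlip : ∀ t ∈ Icc A B, LipschitzWith K (F t))
    (hcont : ∀ x, ContinuousOn (F · x) (Icc A B)) (hbd : ∀ t ∈ Icc A B, ∀ x, ‖F t x‖ ≤ L)
    (x₀ : E) (r : NNReal) :
    ∃ α : E → ℝ → E, (∀ x ∈ Metric.closedBall x₀ r, α x A = x ∧
      ∀ t ∈ Icc A B, HasDerivWithinAt (α x) (F t (α x t)) (Icc A B) t) ∧
      ∃ L' : NNReal, ∀ t ∈ Icc A B, LipschitzOnWith L' (α · t) (Metric.closedBall x₀ r) := by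
  have h : IsPicardLindelof F (⟨A, le_rfl, hAB⟩ : Icc A B) x₀
      (r + L * (B - A).toNNReal) r L K :=
    { lipschitzOnWith := fun t ht => (hlip t ht).lipschitzOnWith
      continuousOn := fun x _ => hcont x
      norm_le := fun t ht x _ => hbd t ht x
      mul_max_le := by
        simp [max_eq_left (sub_nonneg.2 hAB)] }
  exact h.exists_forall_mem_closedBall_eq_hasDerivWithinAt_lipschitzOnWith

theorem abs_clamp_sub_clamp_le (x y s t : ℝ) :
    |max x (min s y) - max x (min t y)| ≤ |s - t| := by
  have h : LipschitzWith 1 fun s : ℝ => max x (min s y) :=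
    (LipschitzWith.id.min_const y).const_max x
  have := h.dist_le_mul s t
  rwa [NNReal.coe_one, one_mul, Real.dist_eq, Real.dist_eq] at this

theorem exists_abs_clamp_rpow_sub_le {K p : ℝ} (hK : 0 ≤ K) (hp : 1 < p) :
    ∃ Q ≥ 0, ∀ x y : ℝ, |max 0 (min x K) ^ p - max 0 (min y K) ^ p| ≤ Q * |x - y| := by
  have h1 : ContDiffOn ℝ 1 (fun x : ℝ => x ^ p) (Icc 0 K) :=
    (contDiff_rpow_const_of_le (n := 1) (by exact_mod_cast hp.le)).contDiffOn
  obtain ⟨Q, hQ⟩ := h1.exists_lipschitzOnWith one_ne_zero (convex_Icc 0 K) isCompact_Icc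
  refine ⟨Q, Q.2, fun x y => ?_⟩
  have mem : ∀ z, max 0 (min z K) ∈ Icc 0 K := fun z =>
    ⟨le_max_left _ _, max_le hK (min_le_right _ _)⟩
  have h2 := hQ.dist_le_mul _ (mem x) _ (mem y)
  rw [Real.dist_eq, Real.dist_eq] at h2
  exact h2.trans (mul_le_mul_of_nonneg_left (abs_clamp_sub_clamp_le 0 K x y) Q.2)

/-- The normalised shooting problems with coupling `μ ∈ [0, R]` are solvable on `[A, B]`, and the
value at `B` depends continuously on `μ`. -/
theorem exists_shooting_family {lam Lam n A B p c S R : ℝ} {ρ : ℝ → ℝ} (hlam : 0 < lam)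
    (hlL : lam ≤ Lam) (hn : 0 < n) (hA : 0 < A) (hAB : A < B) (hp : 1 < p) (hc : 0 < c)
    (hρ : ContinuousOn ρ (Icc A B)) (hcρ : ∀ t ∈ Icc A B, c ≤ ρ t)
    (hρS : ∀ t ∈ Icc A B, ρ t ≤ S) (hR : 0 ≤ R) :
    ∃ w v : ℝ → ℝ → ℝ, ContinuousOn (fun μ => w μ B) (Icc 0 R) ∧ ∀ μ ∈ Icc 0 R,
      IsShootingPair A B p (n * Lam / (lam * A)) (n / A) (c / Lam) (S / Lam) μ (w μ) (v μ)
        (fun t => radialAccel lam Lam n t (v μ t) (μ * ρ t * max 0 (w μ t) ^ p)) := by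
  have hLam := hlam.trans_le hlL
  have hK : 0 ≤ B - A := (sub_pos.2 hAB).le
  have hB : 0 < B := hA.trans hAB
  have hS : 0 < S := hc.trans_le ((hcρ A ⟨le_rfl, hAB.le⟩).trans (hρS A ⟨le_rfl, hAB.le⟩))
  obtain ⟨Q, hQ0, hQ⟩ := exists_abs_clamp_rpow_sub_le hK hp
  set V : ℝ := (R * S * (B - A) ^ p + 1) * B / (n * Lam) with hV
  have hKp : 0 ≤ (B - A) ^ p := rpow_nonneg hK p
  have hV0 : 0 < V := by positivity
  set cv : ℝ → ℝ := fun y => max (-V) (min y 1) with hcv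
  set cm : ℝ → ℝ := fun y => max 0 (min y R) with hcm
  set P : ℝ → ℝ := fun y => max 0 (min y (B - A)) ^ p with hP
  have hcv_lip : ∀ x y, |cv x - cv y| ≤ |x - y| := abs_clamp_sub_clamp_le (-V) 1
  have hcm_lip : ∀ x y, |cm x - cm y| ≤ |x - y| := abs_clamp_sub_clamp_le 0 R
  have hcm0 : ∀ y, 0 ≤ cm y := fun y => le_max_left _ _
  have hcmR : ∀ y, cm y ≤ R := fun y => max_le hR (min_le_right _ _)
  have hP0 : ∀ y, 0 ≤ P y := fun y => rpow_nonneg (le_max_left _ _) _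
  have hPK : ∀ y, P y ≤ (B - A) ^ p := fun y =>
    rpow_le_rpow (le_max_left _ _) (max_le hK (min_le_right _ _)) (by linarith)
  have hcv_bd : ∀ y, |cv y| ≤ V + 1 := fun y => by
    refine abs_le.2 ⟨?_, ?_⟩
    · linarith [le_max_left (-V) (min y 1)]
    · exact max_le (by linarith) ((min_le_right _ _).trans (by linarith))
  have hρ0 : ∀ t ∈ Icc A B, 0 ≤ ρ t := fun t ht => hc.le.trans (hcρ t ht)
  have hq0 : ∀ t ∈ Icc A B, ∀ y z, 0 ≤ cm y * ρ t * P z := fun t ht y z =>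
    mul_nonneg (mul_nonneg (hcm0 y) (hρ0 t ht)) (hP0 z)
  have hq_bd : ∀ t ∈ Icc A B, ∀ y z, cm y * ρ t * P z ≤ R * S * (B - A) ^ p := fun t ht y z => by
    have h1 := hcmR y
    have h2 := hρS t ht
    have h3 := hPK z
    have h4 := hρ0 t ht
    have h5 := hP0 z
    gcongr
  have hq_lip : ∀ t ∈ Icc A B, ∀ y z y' z', |cm y * ρ t * P z - cm y' * ρ t * P z'| ≤
      S * (B - A) ^ p * |y - y'| + R * S * Q * |z - z'| := fun t ht y z y' z' => by
    have e : cm y * ρ t * P z - cm y' * ρ t * P z' =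
      ρ t * P z * (cm y - cm y') + cm y' * ρ t * (P z - P z') := by ring
    rw [e]
    refine (abs_add_le _ _).trans ?_
    have h0 := hρ0 t ht
    have h1 := hρS t ht
    have h2 := hP0 z
    have h3 := hPK z
    have h4 := hcm0 y'
    have h5 := hcmR y'
    rw [abs_mul (ρ t * P z), abs_mul (cm y' * ρ t), abs_of_nonneg (mul_nonneg h0 h2),
      abs_of_nonneg (mul_nonneg h4 h0),
      mul_assoc (R * S)]
    have h6 := hcm_lip y y'
    have h7 := hQ z z'
    change |P z - P z'| ≤ _ at h7
    gcongr
  set F : ℝ → ℝ × ℝ × ℝ → ℝ × ℝ × ℝ := fun t x =>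
    (cv x.2.1, radialAccel lam Lam n t (cv x.2.1) (cm x.2.2 * ρ t * P x.1), 0) with hF
  set L₁ : ℝ := 1 + (n * Lam / A + (S * (B - A) ^ p + R * S * Q)) / lam with hL₁
  have hL₁0 : 0 ≤ L₁ := by positivity
  set L₂ : ℝ := V + 1 + (n * Lam / A * (V + 1) + R * S * (B - A) ^ p) / lam with hL₂
  have hL₂0 : 0 ≤ L₂ := by positivity
  have hlip : ∀ t ∈ Icc A B, LipschitzWith ⟨L₁, hL₁0⟩ (F t) := by
    intro t ht
    refine LipschitzWith.of_dist_le_mul fun x y => ?_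
    have hx1 : |x.1 - y.1| ≤ dist x y := by
      rw [← Real.dist_eq, Prod.dist_eq]; exact le_max_left _ _
    have hx' : dist x.2 y.2 ≤ dist x y := by
      rw [Prod.dist_eq (x := x)]; exact le_max_right _ _
    have hx2 : |x.2.1 - y.2.1| ≤ dist x y := by
      refine le_trans ?_ hx'
      rw [← Real.dist_eq, Prod.dist_eq]; exact le_max_left _ _
    have hx3 : |x.2.2 - y.2.2| ≤ dist x y := by
      refine le_trans ?_ hx'
      rw [← Real.dist_eq, Prod.dist_eq]; exact le_max_right _ _
    have hv := (hcv_lip x.2.1 y.2.1).trans hx2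
    have hd : 0 ≤ dist x y := dist_nonneg
    change dist (F t x) (F t y) ≤ L₁ * dist x y
    have hsum : 0 ≤ (n * Lam / A + (S * (B - A) ^ p + R * S * Q)) / lam := by positivity
    rw [Prod.dist_eq, Prod.dist_eq]
    refine max_le ?_ (max_le ?_ ?_)
    · rw [Real.dist_eq]
      refine hv.trans ?_
      nlinarith
    · rw [Real.dist_eq]
      refine (abs_radialAccel_sub_le hlam hlL hn hA ht.1).trans ?_
      have h1 := hq_lip t ht x.2.2 x.1 y.2.2 y.1
      calc _ ≤ (n * Lam / A * dist x y +
              (S * (B - A) ^ p * dist x y + R * S * Q * dist x y)) / lam := by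
            gcongr
            refine h1.trans ?_
            gcongr
        _ = (n * Lam / A + (S * (B - A) ^ p + R * S * Q)) / lam * dist x y := by ring
        _ ≤ L₁ * dist x y := by gcongr; linarith
    · simp only [hF, dist_self]
      positivity
  have hzero : ∀ t, radialAccel lam Lam n t 0 0 = 0 := fun t => by
    simp [radialAccel, mminus, Mminus]
  have hbd : ∀ t ∈ Icc A B, ∀ x, ‖F t x‖ ≤ (⟨L₂, hL₂0⟩ : NNReal) := by
    intro t ht x
    change ‖F t x‖ ≤ L₂
    have hsum : 0 ≤ (n * Lam / A * (V + 1) + R * S * (B - A) ^ p) / lam := by positivity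
    rw [Prod.norm_def, Prod.norm_def]
    refine max_le ?_ (max_le ?_ ?_)
    · rw [Real.norm_eq_abs]
      refine (hcv_bd _).trans ?_
      linarith
    · rw [Real.norm_eq_abs]
      have h1 := abs_radialAccel_sub_le (v := cv x.2.1) (q := cm x.2.2 * ρ t * P x.1) (v' := 0)
        (q' := 0) hlam hlL hn hA ht.1
      rw [hzero, sub_zero, sub_zero, sub_zero, abs_of_nonneg (hq0 t ht _ _)] at h1
      refine h1.trans ?_
      have h2 : (n * Lam / A * |cv x.2.1| + cm x.2.2 * ρ t * P x.1) / lam ≤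
          (n * Lam / A * (V + 1) + R * S * (B - A) ^ p) / lam := by
        have h3 := hcv_bd x.2.1
        have h4 := hq_bd t ht x.2.2 x.1
        gcongr
      linarith
    · simpa [hF] using hL₂0
  have hcont : ∀ x, ContinuousOn (F · x) (Icc A B) := by
    intro x
    refine continuousOn_const.prodMk (ContinuousOn.prodMk ?_ continuousOn_const)
    refine (continuous_Mminus hlam hlL).comp_continuousOn ?_
    refine (continuousOn_const.div continuousOn_id fun t ht => (hA.trans_le ht.1).ne').sub ?_
    exact (continuousOn_const.mul hρ).mul continuousOn_const
  obtain ⟨α, hα, L', hL'⟩ := exists_flow_of_bounded_lipschitz hAB.le hlip hcont hbd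
    ((0 : ℝ), (1 : ℝ), (0 : ℝ)) ⟨R, hR⟩
  have hmem : ∀ μ ∈ Icc 0 R, ((0 : ℝ), (1 : ℝ), μ) ∈
      Metric.closedBall ((0 : ℝ), (1 : ℝ), (0 : ℝ)) ((⟨R, hR⟩ : NNReal) : ℝ) := by
    intro μ hμ
    rw [Metric.mem_closedBall, Prod.dist_eq, Prod.dist_eq]
    simp [abs_of_nonneg hμ.1, hμ.2, hR]
  refine ⟨fun μ t => (α (0, 1, μ) t).1, fun μ t => (α (0, 1, μ) t).2.1, ?_, ?_⟩
  · have h1 := (hL' B ⟨hAB.le, le_rfl⟩).continuousOn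
    exact continuous_fst.comp_continuousOn
      (h1.comp (f := fun μ : ℝ => ((0 : ℝ), (1 : ℝ), μ)) (by fun_prop) hmem)
  intro μ hμ
  obtain ⟨hinit, hder⟩ := hα _ (hmem μ hμ)
  set x := α (0, 1, μ) with hx
  have hw : ∀ t ∈ Icc A B, HasDerivWithinAt (fun t => (x t).1) (cv (x t).2.1) (Icc A B) t :=
    fun t ht => (hder t ht).fst
  have hv : ∀ t ∈ Icc A B, HasDerivWithinAt (fun t => (x t).2.1)
      (radialAccel lam Lam n t (cv (x t).2.1) (cm (x t).2.2 * ρ t * P (x t).1)) (Icc A B) t :=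
    fun t ht => (hder t ht).snd.fst
  have hv1 : ∀ t ∈ Icc A B, (x t).2.1 ≤ 1 := by
    refine le_barrier_of_hasDerivWithinAt le_rfl le_rfl hv (fun t => hasDerivAt_const t 1)
      (by rw [hinit]) ?_
    intro t ht hvt
    have htm : t ∈ Icc A B := ⟨ht.1, ht.2.le⟩
    refine radialAccel_neg_of_pos hlam hlL hn (hA.trans_le ht.1) ?_ (hq0 t htm _ _)
    rw [hvt]
    simp [hcv]
  have hvV : ∀ t ∈ Icc A B, -V ≤ (x t).2.1 := by
    refine barrier_le_of_hasDerivWithinAt le_rfl le_rfl hv (fun t => hasDerivAt_const t (-V))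
      (by rw [hinit]; simp only; linarith) ?_
    intro t ht hvt
    have htm : t ∈ Icc A B := ⟨ht.1, ht.2.le⟩
    have hcvt : cv (x t).2.1 = -V := by
      rw [hvt]; exact max_eq_left (min_le_left _ _)
    refine radialAccel_pos_of_neg hlam (hA.trans_le ht.1) (by rw [hcvt]; linarith) ?_
    rw [hcvt, neg_neg]
    have e : n * Lam * V = (R * S * (B - A) ^ p + 1) * B := by rw [hV]; field_simp
    rw [e]
    have h1 := hq_bd t htm (x t).2.2 (x t).1
    have h2 := hq0 t htm (x t).2.2 (x t).1
    have h3 : 0 < t := hA.trans_le ht.1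
    have h4 := ht.2
    calc _ ≤ R * S * (B - A) ^ p * B := by gcongr
      _ < _ := by linarith
  have hcvx : ∀ t ∈ Icc A B, cv (x t).2.1 = (x t).2.1 := fun t ht => by
    simp only [hcv]
    rw [min_eq_left (hv1 t ht), max_eq_right (hvV t ht)]
  have hw' : ∀ t ∈ Icc A B, HasDerivWithinAt (fun t => (x t).1) (x t).2.1 (Icc A B) t :=
    fun t ht => by simpa only [hcvx t ht] using hw t ht
  have hμx : ∀ t ∈ Icc A B, (x t).2.2 = μ := by
    have h1 : ∀ t ∈ Icc A B, HasDerivWithinAt (fun t => (x t).2.2) 0 (Icc A B) t :=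
      fun t ht => (hder t ht).snd.snd
    intro t ht
    rcases ht.1.eq_or_lt with rfl | hlt
    · rw [hinit]
    obtain ⟨y, -, hy⟩ := exists_eq_mul_sub_of_hasDerivWithinAt le_rfl ht.2 hlt h1
    rw [hy, hinit]
    simp
  have hwle : ∀ t ∈ Icc A B, (x t).1 ≤ B - A := by
    intro t ht
    rcases ht.1.eq_or_lt with rfl | hlt
    · rw [hinit]; exact hK
    obtain ⟨y, hy, h⟩ := exists_eq_mul_sub_of_hasDerivWithinAt le_rfl ht.2 hlt hw'
    rw [hinit] at h
    have := hv1 y ⟨hy.1.le, hy.2.le.trans ht.2⟩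
    simp only at h
    nlinarith [ht.2]
  have hq : ∀ t ∈ Icc A B, cm (x t).2.2 * ρ t * P (x t).1 = μ * ρ t * max 0 (x t).1 ^ p := by
    intro t ht
    simp only [hP, hcm, hμx t ht]
    rw [min_eq_left hμ.2, max_eq_right hμ.1, min_eq_left (hwle t ht)]
  have hW : ∀ t, 0 ≤ max 0 (x t).1 ^ p := fun t => rpow_nonneg (le_max_left _ _) _
  have hμ0 := hμ.1
  refine ⟨congrArg Prod.fst hinit, congrArg (fun z => z.2.1) hinit, hw', ?_, hv1, ?_, ?_⟩
  · intro t ht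
    have := hv t ht
    rwa [hq t ht, hcvx t ht] at this
  · intro t ht
    have h1 := hρ0 t ht
    have h2 := hcρ t ht
    have h3 := hW t
    refine (radialAccel_le hlam hlL hn hA ht.1 (by positivity)).trans ?_
    gcongr
    calc c / Lam * μ * max 0 (x t).1 ^ p = μ * c * max 0 (x t).1 ^ p / Lam := by ring
      _ ≤ _ := by gcongr
  · intro t ht hvt
    have h2 := hρS t ht
    have h3 := hW t
    refine le_trans ?_ (le_radialAccel hlam hlL hn hA ht.1 hvt)
    gcongr
    calc _ ≤ μ * S * max 0 (x t).1 ^ p / Lam := by gcongr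
      _ = _ := by ring

/-- Existence of a positive radial solution of `𝓜⁻(D²u) + |x|^a u^p = 0`
vanishing on the boundary of an arbitrary annulus `{𝔞 < |x| < 𝔟}`. -/
theorem annulus_solution_pucci_min
    (N : ℕ) (hN : 3 ≤ N) (lam Lam : ℝ) (hlam : 0 < lam) (hlL : lam ≤ Lam)
    (p a : ℝ) (hp : 1 < p) (ha : -1 < a)
    (𝔞 𝔟 : ℝ) (h𝔞 : 0 < 𝔞) (hab : 𝔞 < 𝔟) :
    ∃ u : ℝ → ℝ, ContDiffOn ℝ 2 u (Icc 𝔞 𝔟) ∧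
      (∀ r ∈ Ioo 𝔞 𝔟, 0 < u r) ∧ u 𝔞 = 0 ∧ u 𝔟 = 0 ∧
      ∀ r ∈ Ioo 𝔞 𝔟,
        deriv (deriv u) r =
          Mminus lam Lam
            (-(((N : ℝ) - 1) * mminus lam Lam (deriv u r)) / r - r ^ a * u r ^ p) := by
  have hn : (0 : ℝ) < (N : ℝ) - 1 := by
    have : (3 : ℝ) ≤ N := by exact_mod_cast hN
    linarith
  have hLam := hlam.trans_le hlL
  have hρ : ContinuousOn (fun r : ℝ => r ^ a) (Icc 𝔞 𝔟) := fun r hr =>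
    (continuousAt_rpow_const r a (Or.inl (h𝔞.trans_le hr.1).ne')).continuousWithinAt
  have hne : (Icc 𝔞 𝔟).Nonempty := ⟨𝔞, le_rfl, hab.le⟩
  obtain ⟨r₁, hr₁, hmin⟩ := isCompact_Icc.exists_isMinOn hne hρ
  obtain ⟨r₂, hr₂, hmax⟩ := isCompact_Icc.exists_isMaxOn hne hρ
  have hc : 0 < r₁ ^ a := rpow_pos_of_pos (h𝔞.trans_le hr₁.1) a
  have hS : 0 < r₂ ^ a := rpow_pos_of_pos (h𝔞.trans_le hr₂.1) a
  obtain ⟨R, hR, hRneg⟩ := exists_forall_isShootingPair_w_right_neg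
    (C := ((N : ℝ) - 1) * Lam / (lam * 𝔞)) (k := ((N : ℝ) - 1) / 𝔞) (l := r₁ ^ a / Lam)
    (m := r₂ ^ a / Lam) hab (zero_le_one.trans hp.le) (by positivity) (by positivity)
    (by positivity) (by positivity)
  obtain ⟨w, v, hcont, hsol⟩ := exists_shooting_family hlam hlL hn h𝔞 hab hp hc hρ
    (fun t ht => hmin ht) (fun t ht => hmax ht) hR.le
  obtain ⟨μ, hμ, hμB⟩ : ∃ μ ∈ Icc 0 R, w μ 𝔟 = 0 :=
    intermediate_value_Icc' hR.le hcont
      ⟨(hRneg _ _ _ (hsol R ⟨hR.le, le_rfl⟩)).le,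
        ((hsol 0 ⟨le_rfl, hR.le⟩).w_right_pos hab).le⟩
  have hμ0 : 0 < μ := by
    refine lt_of_le_of_ne hμ.1 ?_
    rintro rfl
    exact ((hsol 0 hμ).w_right_pos hab).ne' hμB
  have h := hsol μ hμ
  have hwpos : ∀ r ∈ Ioo 𝔞 𝔟, 0 < w μ r := fun r hr =>
    h.w_pos (by positivity) (by positivity) hμ.1 hμB.ge hr
  have hwnonneg : ∀ r ∈ Icc 𝔞 𝔟, 0 ≤ w μ r := by
    intro r hr
    rcases hr.1.eq_or_lt with rfl | h1
    · exact h.w_left.ge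
    rcases hr.2.eq_or_lt with rfl | h2
    · exact hμB.ge
    exact (hwpos r ⟨h1, h2⟩).le
  set s : ℝ := μ ^ (1 / (p - 1)) with hs
  have hs0 : 0 < s := rpow_pos_of_pos hμ0 _
  have hsp : s ^ p = s * μ := by
    have hp1 : p - 1 ≠ 0 := by linarith
    rw [hs, ← rpow_mul hμ0.le, ← rpow_add_one hμ0.ne']
    congr 1
    field_simp
    ring
  set g : ℝ → ℝ := fun t => radialAccel lam Lam ((N : ℝ) - 1) t (v μ t)
    (μ * t ^ a * max 0 (w μ t) ^ p) with hg
  have hu : ∀ t ∈ Icc 𝔞 𝔟, HasDerivWithinAt (fun r => s * w μ r) (s * v μ t) (Icc 𝔞 𝔟) t :=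
    fun t ht => (h.hasDeriv_w t ht).const_mul s
  have hu' : ∀ t ∈ Icc 𝔞 𝔟, HasDerivWithinAt (fun r => s * v μ r) (s * g t) (Icc 𝔞 𝔟) t :=
    fun t ht => (h.hasDeriv_v t ht).const_mul s
  have hwc : ContinuousOn (w μ) (Icc 𝔞 𝔟) := fun t ht => (h.hasDeriv_w t ht).continuousWithinAt
  have hvc : ContinuousOn (v μ) (Icc 𝔞 𝔟) := fun t ht => (h.hasDeriv_v t ht).continuousWithinAt
  have hgc : ContinuousOn g (Icc 𝔞 𝔟) := by
    refine (continuous_Mminus hlam hlL).comp_continuousOn ?_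
    refine ((continuousOn_const.mul ((continuous_mminus hlL).comp_continuousOn hvc)).neg.div
      continuousOn_id fun t ht => (h𝔞.trans_le ht.1).ne').sub ?_
    exact (continuousOn_const.mul hρ).mul
      ((continuousOn_const.sup hwc).rpow_const fun _ _ => Or.inr (by linarith))
  have hud := uniqueDiffOn_Icc hab
  have hdu : ∀ t ∈ Icc 𝔞 𝔟, derivWithin (fun r => s * w μ r) (Icc 𝔞 𝔟) t = s * v μ t :=
    fun t ht => (hu t ht).derivWithin (hud t ht)
  have hdu' : ∀ t ∈ Icc 𝔞 𝔟, derivWithin (fun r => s * v μ r) (Icc 𝔞 𝔟) t = s * g t :=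
    fun t ht => (hu' t ht).derivWithin (hud t ht)
  have hderiv : ∀ t ∈ Ioo 𝔞 𝔟, deriv (fun r => s * w μ r) t = s * v μ t := fun t ht =>
    ((hu t ⟨ht.1.le, ht.2.le⟩).hasDerivAt (Icc_mem_nhds ht.1 ht.2)).deriv
  refine ⟨fun r => s * w μ r, ?_, fun r hr => mul_pos hs0 (hwpos r hr), ?_, ?_, ?_⟩
  · rw [show (2 : WithTop ℕ∞) = 1 + 1 from one_add_one_eq_two.symm,
      contDiffOn_succ_iff_derivWithin hud]
    refine ⟨fun t ht => (hu t ht).differentiableWithinAt, by simp, ?_⟩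
    refine ContDiffOn.congr ?_ hdu
    rw [contDiffOn_one_iff_derivWithin hud]
    exact ⟨fun t ht => (hu' t ht).differentiableWithinAt,
      (continuousOn_const.mul hgc).congr hdu'⟩
  · simp [h.w_left]
  · simp [hμB]
  · intro r hr
    have h1 : deriv (fun r => s * w μ r) =ᶠ[nhds r] fun r => s * v μ r :=
      Filter.eventually_of_mem (Ioo_mem_nhds hr.1 hr.2) hderiv
    have hr' : r ∈ Icc 𝔞 𝔟 := ⟨hr.1.le, hr.2.le⟩
    rw [h1.deriv_eq, ((hu' r hr').hasDerivAt (Icc_mem_nhds hr.1 hr.2)).deriv, hderiv r hr, hg]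
    simp only
    rw [← radialAccel_const_mul hlam hlL hs0.le, radialAccel, max_eq_right (hwpos r hr).le,
      mul_rpow hs0.le (hwpos r hr).le, hsp]
    congr 2
    ring
end

section
/- Let (x,z) : I → ℝ² be a C¹ solution on an open interval I of the system (DS⁺): x'(t) = x(t)(x(t)+1) − M₊(λ(N−1)x(t) − z(t)), z'(t) = z(t)(x(t) + 2 + a − p·x(t)), with x(t) > 0 and z(t) > 0 for all t ∈ I. Define u on J = {e^t : t ∈ I} by u(r) = r^{−α}·z(ln r)^{1/(p−1)}, where α = (2+a)/(p−1). Then u is C² and positive on J, u'(r) = −x(ln r)·u(r)/r < 0 for all r ∈ J, and u satisfies (P₊): u''(r) = M₊(−(N−1)·m₊(u'(r))/r − r^a·u(r)^p) on J. -/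
open Real Set

noncomputable def mplus (lam Lam s : ℝ) : ℝ := if s ≤ 0 then lam * s else Lam * s

noncomputable def Mplus (lam Lam s : ℝ) : ℝ := if s ≤ 0 then s / lam else s / Lam

/-- `Mplus` is positively homogeneous. -/
theorem Mplus_mul_of_pos (lam Lam s : ℝ) {c : ℝ} (hc : 0 < c) :
    Mplus lam Lam (c * s) = c * Mplus lam Lam s := by
  unfold Mplus
  have h : c * s ≤ 0 ↔ s ≤ 0 := by
    rw [mul_nonpos_iff]
    constructor
    · rintro (h | h)
      · exact h.2
      · linarith [h.1]
    · exact fun h => Or.inl ⟨hc.le, h⟩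
  simp only [h]
  split_ifs <;> ring

/-- The derivative of `r ↦ r ^ (-α) * z (log r) ^ β` in terms of the derivative of `z`. -/
theorem hasDerivAt_rpow_mul_comp_log_rpow {z : ℝ → ℝ} {α β c r : ℝ} (hr : 0 < r)
    (hz : 0 < z (Real.log r))
    (hdz : HasDerivAt z (z (Real.log r) * c) (Real.log r)) :
    HasDerivAt (fun s => s ^ (-α) * z (Real.log s) ^ β)
      ((β * c - α) * (r ^ (-α) * z (Real.log r) ^ β) / r) r := by
  have h1 := (Real.hasDerivAt_rpow_const (x := r) (p := -α) (Or.inl hr.ne'))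
  have h2 := ((hdz.comp r (Real.hasDerivAt_log hr.ne')).rpow_const (p := β)
    (Or.inl hz.ne'))
  refine (h1.mul h2).congr_deriv ?_
  simp only [Function.comp_apply]
  rw [Real.rpow_sub_one hr.ne', Real.rpow_sub_one hz.ne']
  field_simp
  ring

/-- From a positive trajectory `(x,z)` of the system (DS⁺) one recovers a positive,
strictly decreasing C² solution `u(r) = r^{-α} z(ln r)^{1/(p-1)}` of (P₊), with
`u'(r) = -x(ln r) u(r)/r`. -/
theorem trajectory_gives_radial_solution
    (N : ℕ) (hN : 3 ≤ N) (lam Lam : ℝ) (hlam : 0 < lam) (hlL : lam ≤ Lam)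
    (p a : ℝ) (hp : 1 < p) (ha : -1 < a)
    (hNt : 2 < lam / Lam * ((N : ℝ) - 1) + 1)
    (I : Set ℝ) (hIopen : IsOpen I) (hconn : I.OrdConnected)
    (x z : ℝ → ℝ) (hx : ContDiffOn ℝ 1 x I) (hz : ContDiffOn ℝ 1 z I)
    (hxpos : ∀ t ∈ I, 0 < x t) (hzpos : ∀ t ∈ I, 0 < z t)
    (hdx : ∀ t ∈ I, HasDerivAt x
      (x t * (x t + 1) - Mplus lam Lam (lam * ((N : ℝ) - 1) * x t - z t)) t)
    (hdz : ∀ t ∈ I, HasDerivAt z (z t * (x t + 2 + a - p * x t)) t)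
    (α : ℝ) (hα : α = (2 + a) / (p - 1))
    (u : ℝ → ℝ) (hu : ∀ r, u r = r ^ (-α) * z (Real.log r) ^ (1 / (p - 1)))
    (J : Set ℝ) (hJ : J = Real.exp '' I) :
    ContDiffOn ℝ 2 u J ∧
    (∀ r ∈ J, 0 < u r) ∧
    (∀ r ∈ J, deriv u r = -(x (Real.log r)) * u r / r ∧ deriv u r < 0) ∧
    (∀ r ∈ J, deriv (deriv u) r =
      Mplus lam Lam
        (-(((N : ℝ) - 1) * mplus lam Lam (deriv u r)) / r - r ^ a * u r ^ p)) := by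
  have hp1 : 0 < p - 1 := by linarith
  have hJpos : ∀ r ∈ J, 0 < r := by
    rintro r hr
    rw [hJ] at hr
    obtain ⟨t, -, rfl⟩ := hr
    exact Real.exp_pos t
  have hlog : MapsTo Real.log J I := by
    intro r hr
    rw [hJ] at hr
    obtain ⟨t, ht, rfl⟩ := hr
    rwa [Real.log_exp]
  have hJopen : IsOpen J := hJ ▸ Real.isOpenEmbedding_exp.isOpenMap I hIopen
  have hupos : ∀ r ∈ J, 0 < u r := fun r hr => by
    rw [hu]
    exact mul_pos (Real.rpow_pos_of_pos (hJpos r hr) _)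
      (Real.rpow_pos_of_pos (hzpos _ (hlog hr)) _)
  have hdu : ∀ r ∈ J, HasDerivAt u (-(x (Real.log r)) * u r / r) r := fun r hr => by
    have h := hasDerivAt_rpow_mul_comp_log_rpow (α := α) (β := 1 / (p - 1)) (hJpos r hr)
      (hzpos _ (hlog hr)) (hdz _ (hlog hr))
    rw [← funext hu, ← hu] at h
    refine h.congr_deriv ?_
    have hcoef : 1 / (p - 1) * (x (Real.log r) + 2 + a - p * x (Real.log r)) - α
        = -x (Real.log r) := by
      rw [hα]
      field_simp
      ring
    rw [hcoef]
  have hderiv : ∀ r ∈ J, deriv u r = -(x (Real.log r)) * u r / r :=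
    fun r hr => (hdu r hr).deriv
  have hlogC : ContDiffOn ℝ 1 Real.log J := fun r hr =>
    (Real.contDiffAt_log.2 (hJpos r hr).ne').contDiffWithinAt
  have huC : ContDiffOn ℝ 1 u J := by
    rw [funext hu]
    refine ContDiffOn.mul (fun r hr => ?_) ?_
    · exact (Real.contDiffAt_rpow_const_of_ne (hJpos r hr).ne').contDiffWithinAt
    · exact (hz.comp hlogC hlog).rpow_const_of_ne fun r hr => (hzpos _ (hlog hr)).ne'
  refine ⟨?_, hupos, fun r hr => ⟨hderiv r hr, ?_⟩, fun r hr => ?_⟩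
  · rw [← one_add_one_eq_two, contDiffOn_succ_iff_deriv_of_isOpen hJopen]
    refine ⟨fun r hr => (hdu r hr).differentiableAt.differentiableWithinAt, by simp, ?_⟩
    exact (((hx.comp hlogC hlog).neg.mul huC).div contDiffOn_id
      fun r hr => (hJpos r hr).ne').congr hderiv
  · rw [hderiv r hr]
    exact div_neg_of_neg_of_pos
      (mul_neg_of_neg_of_pos (neg_neg_of_pos (hxpos _ (hlog hr))) (hupos r hr)) (hJpos r hr)
  · have hr0 := hJpos r hr
    have hur := hupos r hr
    have hxr := hxpos _ (hlog hr)
    have hm : mplus lam Lam (deriv u r) = lam * (-(x (Real.log r)) * u r / r) := by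
      rw [hderiv r hr, mplus, if_pos]
      exact div_nonpos_of_nonpos_of_nonneg (by nlinarith [mul_pos hxr hur]) hr0.le
    have hpow : r ^ a * u r ^ p = u r / r ^ 2 * z (Real.log r) := by
      have hup : u r ^ (p - 1) = r ^ (-(2 + a)) * z (Real.log r) := by
        have hzr := hzpos _ (hlog hr)
        rw [hu, Real.mul_rpow (Real.rpow_nonneg hr0.le _) (Real.rpow_nonneg hzr.le _),
          ← Real.rpow_mul hr0.le, ← Real.rpow_mul hzr.le, one_div_mul_cancel hp1.ne',
          Real.rpow_one, hα, neg_mul, div_mul_cancel₀ _ hp1.ne']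
      have hra : r ^ a * r ^ (-(2 + a)) = (r ^ 2)⁻¹ := by
        rw [← Real.rpow_add hr0, show a + -(2 + a) = -((2 : ℕ) : ℝ) by push_cast; ring,
          Real.rpow_neg hr0.le, Real.rpow_natCast]
      rw [← sub_add_cancel p 1, Real.rpow_add_one hur.ne', hup, div_eq_mul_inv, ← hra]
      ring
    have harg : -(((N : ℝ) - 1) * mplus lam Lam (deriv u r)) / r - r ^ a * u r ^ p
        = u r / r ^ 2 * (lam * ((N : ℝ) - 1) * x (Real.log r) - z (Real.log r)) := by
      rw [hm, hpow]
      field_simp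
    have hd : HasDerivAt (fun s => -(x (Real.log s)) * u s / s) _ r :=
      ((((hdx _ (hlog hr)).comp r (Real.hasDerivAt_log hr0.ne')).neg.mul (hdu r hr)).div
        (hasDerivAt_id r) hr0.ne')
    have heq : deriv u =ᶠ[nhds r] fun s => -(x (Real.log s)) * u s / s :=
      Filter.eventuallyEq_of_mem (hJopen.mem_nhds hr) hderiv
    rw [harg, Mplus_mul_of_pos _ _ _ (by positivity), heq.deriv_eq, hd.deriv]
    simp only [Pi.neg_apply, Pi.mul_apply, Function.comp_apply]
    field_simp
    ring
end

section
/- Let t̂ ∈ ℝ and let (x,z) : [t̂, ∞) → ℝ² be a C¹ solution of (DS⁺): x' = x(x+1) − M₊(λ(N−1)x − z), z' = z(x+2+a−px), with x(t) > 0 and z(t) > 0 for all t ≥ t̂. Then x(t) < Ñ₊ − 2 for all t ≥ t̂. -/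
open Real Set

lemma Mplus_le_div {lam Lam : ℝ} (hlam : 0 < lam) (hlL : lam ≤ Lam) (s : ℝ) :
    Mplus lam Lam s ≤ s / Lam := by
  unfold Mplus
  split_ifs with hs
  · rw [div_le_div_iff₀ hlam (hlam.trans_le hlL)]
    exact mul_le_mul_of_nonpos_left hlL hs
  · exact le_rfl

/-- A function on `[t₀, ∞)` satisfying `y² ≤ y'` is nowhere positive. -/
lemma not_forall_pos_of_sq_le_deriv {y y' : ℝ → ℝ} {t₀ : ℝ}
    (hy : ∀ t, t₀ ≤ t → HasDerivAt y (y' t) t) (hsq : ∀ t, t₀ ≤ t → y t ^ 2 ≤ y' t) :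
    ¬ ∀ t, t₀ ≤ t → 0 < y t := by
  intro hpos
  have hd : ∀ t, t₀ ≤ t → HasDerivAt (fun s ↦ (y s)⁻¹ + s) (-y' t / y t ^ 2 + 1) t :=
    fun t ht ↦ ((hy t ht).fun_inv (hpos t ht).ne').add (hasDerivAt_id t)
  have hanti : AntitoneOn (fun s ↦ (y s)⁻¹ + s) (Ici t₀) := by
    refine antitoneOn_of_hasDerivWithinAt_nonpos (convex_Ici t₀)
      (fun t ht ↦ (hd t ht).continuousAt.continuousWithinAt)
      (fun t ht ↦ (hd t (interior_subset ht)).hasDerivWithinAt) (fun t ht ↦ ?_)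
    have ht' : t₀ ≤ t := interior_subset ht
    have h := (one_le_div (pow_pos (hpos t ht') 2)).2 (hsq t ht')
    rw [neg_div]
    linarith
  have h₀ := inv_pos.2 (hpos t₀ le_rfl)
  have hle : t₀ ≤ t₀ + (y t₀)⁻¹ := by linarith
  have h₁ := inv_pos.2 (hpos _ hle)
  have h₂ := hanti (mem_Ici.2 le_rfl) (mem_Ici.2 hle) hle
  dsimp only at h₂
  linarith

/-- If `x' > x (x - c)` on `[t₀, ∞)` with `c ≥ 0`, then `x` stays below `c`: otherwise it would
blow up in finite time. -/
lemma lt_of_mul_sub_lt_deriv {x x' : ℝ → ℝ} {t₀ c : ℝ} (hc : 0 ≤ c)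
    (hx : ∀ t, t₀ ≤ t → HasDerivAt x (x' t) t) (h : ∀ t, t₀ ≤ t → x t * (x t - c) < x' t) :
    x t₀ < c := by
  by_contra! h₀
  have hge : ∀ t, t₀ ≤ t → c ≤ x t := fun t ht ↦
    image_le_of_deriv_right_lt_deriv_boundary' (f := fun _ ↦ c) (f' := fun _ ↦ 0)
      (a := t₀) (b := t) continuousOn_const
      (fun s _ ↦ hasDerivWithinAt_const s _ c) h₀
      (fun s hs ↦ (hx s hs.1).continuousAt.continuousWithinAt)
      (fun s hs ↦ (hx s hs.1).hasDerivWithinAt)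
      (fun s hs hcs ↦ by simpa [← hcs] using h s hs.1) (right_mem_Icc.2 ht)
  have hmono : StrictMonoOn x (Ici t₀) := by
    refine strictMonoOn_of_hasDerivWithinAt_pos (convex_Ici t₀)
      (fun t ht ↦ (hx t ht).continuousAt.continuousWithinAt)
      (fun t ht ↦ (hx t (interior_subset ht)).hasDerivWithinAt) (fun t ht ↦ ?_)
    have ht' : t₀ ≤ t := interior_subset ht
    have hct := hge t ht'
    exact (mul_nonneg (hc.trans hct) (sub_nonneg.2 hct)).trans_lt (h t ht')
  refine not_forall_pos_of_sq_le_deriv (y := fun t ↦ x t - c) (y' := x') (t₀ := t₀ + 1)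
    (fun t ht ↦ (hx t (by linarith)).sub_const c) (fun t ht ↦ ?_) (fun t ht ↦ ?_)
  · have ht' : t₀ ≤ t := by linarith
    nlinarith [h t ht', mul_nonneg hc (sub_nonneg.2 (hge t ht'))]
  · exact sub_pos.2 (h₀.trans_lt
      (hmono (mem_Ici.2 le_rfl) (mem_Ici.2 (by linarith)) (by linarith)))

/-- A priori bound: a trajectory of (DS⁺) staying in the open first quadrant for
all forward times `t ≥ tHat` satisfies `x(t) < Ñ₊ - 2`. -/
theorem forward_trajectory_x_bound
    (N : ℕ) (hN : 3 ≤ N) (lam Lam : ℝ) (hlam : 0 < lam) (hlL : lam ≤ Lam)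
    (p a : ℝ) (hp : 1 < p) (ha : -1 < a)
    (Nt : ℝ) (hNtdef : Nt = lam / Lam * ((N : ℝ) - 1) + 1) (hNt : 2 < Nt)
    (tHat : ℝ) (x z : ℝ → ℝ)
    (hdx : ∀ t, tHat ≤ t → HasDerivAt x
      (x t * (x t + 1) - Mplus lam Lam (lam * ((N : ℝ) - 1) * x t - z t)) t)
    (hdz : ∀ t, tHat ≤ t → HasDerivAt z (z t * (x t + 2 + a - p * x t)) t)
    (hxpos : ∀ t, tHat ≤ t → 0 < x t) (hzpos : ∀ t, tHat ≤ t → 0 < z t) :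
    ∀ t, tHat ≤ t → x t < Nt - 2 := by
  intro t ht
  have hLam : 0 < Lam := hlam.trans_le hlL
  refine lt_of_mul_sub_lt_deriv (by linarith) (fun s hs ↦ hdx s (ht.trans hs)) (fun s hs ↦ ?_)
  have hM := Mplus_le_div hlam hlL (lam * ((N : ℝ) - 1) * x s - z s)
  have hz := div_pos (hzpos s (ht.trans hs)) hLam
  have heq : (lam * ((N : ℝ) - 1) * x s - z s) / Lam = (Nt - 1) * x s - z s / Lam := by
    rw [hNtdef]
    ring
  rw [heq] at hM
  linarith
end
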